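/- arXiv:2405.15634 — 3 statements merged into one kernel-verified Lean document; each statement's English description precedes it below -/
import Mathlib

section
/- Proposition 1.1 (combinatorial Cohen–Macaulay criteria, parts (b)⟺(c)⟺(d)): The following are equivalent: (b) AP_S has exactly d elements; (c) AP_S = {(0, 0)} ∪ {(r_i, t_{d−i}) : 1 ≤ i ≤ d − 1}; (d) (r_i, t_{d−i}) ∈ S for all i = 1, …, d − 1. -/
/-- The Apery set of a submonoid `S ⊆ ℕ` with respect to `d`:
elements `y ∈ S` such that `y - d ∉ S`. -/
def AperyN (S : AddSubmonoid ℕ) (d : ℕ) : Set ℕ :=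
  {y | y ∈ S ∧ ¬ ∃ s ∈ S, y = s + d}

/-- The Apery set of a submonoid `S ⊆ ℕ × ℕ` with respect to `(0,d)` and `(d,0)`. -/
def AperyP (S : AddSubmonoid (ℕ × ℕ)) (d : ℕ) : Set (ℕ × ℕ) :=
  {y | y ∈ S ∧ (¬ ∃ s ∈ S, y = s + ((0 : ℕ), d)) ∧ (¬ ∃ s ∈ S, y = s + (d, (0 : ℕ)))}

/-- The partial order induced by a submonoid of `ℕ`. -/
def leN (S : AddSubmonoid ℕ) (y z : ℕ) : Prop := ∃ s ∈ S, z = y + s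

/-- The partial order induced by a submonoid of `ℕ × ℕ`. -/
def leP (S : AddSubmonoid (ℕ × ℕ)) (y z : ℕ × ℕ) : Prop := ∃ s ∈ S, z = y + s

/-- The numerical semigroup `S₁` generated by `a 1, …, a n`. -/
def Smon1 (n : ℕ) (a : ℕ → ℕ) : AddSubmonoid ℕ :=
  AddSubmonoid.closure {x | ∃ i, 1 ≤ i ∧ i ≤ n ∧ x = a i}

/-- The numerical semigroup `S₂` generated by `d - a 0, …, d - a (n-1)`. -/
def Smon2 (n d : ℕ) (a : ℕ → ℕ) : AddSubmonoid ℕ :=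
  AddSubmonoid.closure {x | ∃ i, i < n ∧ x = d - a i}

/-- The monoid `S ⊆ ℕ × ℕ` generated by the `(a i, d - a i)`, `i = 0, …, n`. -/
def SmonH (n d : ℕ) (a : ℕ → ℕ) : AddSubmonoid (ℕ × ℕ) :=
  AddSubmonoid.closure {p | ∃ i, i ≤ n ∧ p = (a i, d - a i)}

theorem aperyN_zero_mem {S : AddSubmonoid ℕ} {d : ℕ} (hd : 0 < d) : 0 ∈ AperyN S d :=
  ⟨S.zero_mem, by rintro ⟨s, -, h⟩; omega⟩

/-- Subtracting `d` as often as possible moves any element of `S` into the Apery set. -/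
theorem exists_eq_aperyN_add_mul {S : AddSubmonoid ℕ} {d : ℕ} (hd : 0 < d) :
    ∀ x ∈ S, ∃ w ∈ AperyN S d, ∃ k, x = w + k * d := by
  intro x
  induction x using Nat.strong_induction_on with
  | _ x ih =>
    intro hx
    by_cases h : ∃ s ∈ S, x = s + d
    · obtain ⟨s, hs, rfl⟩ := h
      obtain ⟨w, hw, k, rfl⟩ := ih s (by omega) hs
      exact ⟨w, hw, k + 1, by ring⟩
    · exact ⟨x, ⟨hx, h⟩, 0, by simp⟩

theorem mk_mem_aperyP {S₁ S₂ : AddSubmonoid ℕ} {S : AddSubmonoid (ℕ × ℕ)} {d x y : ℕ}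
    (hle : S ≤ S₁.prod S₂) (hx : x ∈ AperyN S₁ d) (hy : y ∈ AperyN S₂ d) (h : (x, y) ∈ S) :
    (x, y) ∈ AperyP S d := by
  refine ⟨h, ?_, ?_⟩
  · rintro ⟨s, hs, e⟩
    exact hy.2 ⟨s.2, (hle hs).2, congrArg Prod.snd e⟩
  · rintro ⟨s, hs, e⟩
    exact hx.2 ⟨s.1, (hle hs).1, congrArg Prod.fst e⟩

theorem exists_mk_left_mem_aperyP {S₁ : AddSubmonoid ℕ} {S : AddSubmonoid (ℕ × ℕ)} {d x : ℕ}
    (hd : 0 < d) (hfst : ∀ p ∈ S, p.1 ∈ S₁) (hx : x ∈ AperyN S₁ d) (h : ∃ y, (x, y) ∈ S) :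
    ∃ y, (x, y) ∈ AperyP S d := by
  classical
  refine ⟨Nat.find h, Nat.find_spec h, ?_, ?_⟩
  · rintro ⟨⟨s, u⟩, hs, e⟩
    simp only [Prod.mk_add_mk, add_zero, Prod.mk.injEq] at e
    obtain ⟨rfl, e⟩ := e
    have := Nat.find_min' h hs
    omega
  · rintro ⟨s, hs, e⟩
    exact hx.2 ⟨s.1, hfst s hs, congrArg Prod.fst e⟩

theorem exists_mk_right_mem_aperyP {S₂ : AddSubmonoid ℕ} {S : AddSubmonoid (ℕ × ℕ)} {d y : ℕ}
    (hd : 0 < d) (hsnd : ∀ p ∈ S, p.2 ∈ S₂) (hy : y ∈ AperyN S₂ d) (h : ∃ x, (x, y) ∈ S) :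
    ∃ x, (x, y) ∈ AperyP S d := by
  classical
  refine ⟨Nat.find h, Nat.find_spec h, ?_, ?_⟩
  · rintro ⟨s, hs, e⟩
    exact hy.2 ⟨s.2, hsnd s hs, congrArg Prod.snd e⟩
  · rintro ⟨⟨s, u⟩, hs, e⟩
    simp only [Prod.mk_add_mk, add_zero, Prod.mk.injEq] at e
    obtain ⟨e, rfl⟩ := e
    have := Nat.find_min' h hs
    omega

theorem smonH_le_prod (n d : ℕ) (a : ℕ → ℕ) (h0 : a 0 = 0) (han : a n = d) :
    SmonH n d a ≤ (Smon1 n a).prod (Smon2 n d a) := by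
  refine AddSubmonoid.closure_le.2 ?_
  rintro _ ⟨i, hi, rfl⟩
  refine ⟨?_, ?_⟩
  · rcases Nat.eq_zero_or_pos i with rfl | h
    · simp [h0]
    · exact AddSubmonoid.subset_closure ⟨i, h, hi, rfl⟩
  · rcases hi.eq_or_lt with rfl | h
    · simp [han]
    · exact AddSubmonoid.subset_closure ⟨i, h, rfl⟩

theorem dvd_fst_add_snd_of_mem_smonH {n d : ℕ} {a : ℕ → ℕ} (hle : ∀ i ≤ n, a i ≤ d)
    {p : ℕ × ℕ} (hp : p ∈ SmonH n d a) : d ∣ p.1 + p.2 := by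
  induction hp using AddSubmonoid.closure_induction with
  | mem p hp =>
    obtain ⟨i, hi, rfl⟩ := hp
    simp [Nat.add_sub_cancel' (hle i hi)]
  | zero => simp
  | add p q _ _ hp hq =>
    have := Nat.dvd_add hp hq
    rwa [Prod.fst_add, Prod.snd_add, add_add_add_comm]

theorem exists_mk_left_mem_smonH {n : ℕ} (d : ℕ) {a : ℕ → ℕ} {x : ℕ} (hx : x ∈ Smon1 n a) :
    ∃ y, (x, y) ∈ SmonH n d a := by
  induction hx using AddSubmonoid.closure_induction with
  | mem x hx =>
    obtain ⟨i, -, hi, rfl⟩ := hx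
    exact ⟨_, AddSubmonoid.subset_closure ⟨i, hi, rfl⟩⟩
  | zero => exact ⟨0, (SmonH n d a).zero_mem⟩
  | add x x' _ _ h h' =>
    obtain ⟨y, h⟩ := h
    obtain ⟨y', h'⟩ := h'
    exact ⟨y + y', (SmonH n d a).add_mem h h'⟩

theorem exists_mk_right_mem_smonH {n d : ℕ} {a : ℕ → ℕ} {y : ℕ} (hy : y ∈ Smon2 n d a) :
    ∃ x, (x, y) ∈ SmonH n d a := by
  induction hy using AddSubmonoid.closure_induction with
  | mem y hy =>
    obtain ⟨i, hi, rfl⟩ := hy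
    exact ⟨_, AddSubmonoid.subset_closure ⟨i, hi.le, rfl⟩⟩
  | zero => exact ⟨0, (SmonH n d a).zero_mem⟩
  | add y y' _ _ h h' =>
    obtain ⟨x, h⟩ := h
    obtain ⟨x', h'⟩ := h'
    exact ⟨x + x', (SmonH n d a).add_mem h h'⟩

/-- Points whose first coordinates represent the residues modulo `d` are pairwise distinct. -/
theorem ncard_image_mk_Iio {d : ℕ} {r : ℕ → ℕ} (u : ℕ → ℕ) (hr : ∀ i < d, r i % d = i) :
    ((fun i => (r i, u i)) '' Set.Iio d).ncard = d := by
  have hinj : Set.InjOn (fun i => (r i, u i)) (Set.Iio d) := fun i hi j hj e => by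
    rw [← hr i hi, ← hr j hj, (Prod.mk.inj e).1]
  rw [hinj.ncard_image, ← Finset.coe_Iio, Set.ncard_coe_finset, Nat.card_Iio]

/-- Residues modulo `d` that sum to a multiple of `d` are opposite. -/
theorem Nat.mod_eq_sub_mod_of_dvd_add {d x y : ℕ} (hd : 0 < d) (h : d ∣ x + y) :
    y % d = (d - x % d) % d := by
  have hx := Nat.mod_lt x hd
  have key : (x % d + y) ≡ (x % d + (d - x % d)) [MOD d] := by
    rw [Nat.add_sub_cancel' hx.le]
    refine ((Nat.mod_modEq x d).add_right y).trans ?_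
    rw [Nat.ModEq, Nat.mod_self]
    exact Nat.mod_eq_zero_of_dvd h
  exact key.add_left_cancel'

/-- Proposition 1.1, (b) ⟺ (c) ⟺ (d). Here `r i` (resp. `t i`) is the unique element
of `Ap₁` (resp. `Ap₂`) congruent to `i` modulo `d`, for `i < d`. -/
theorem stmt1 (n d : ℕ) (a : ℕ → ℕ) (hd : 0 < d) (hn : 2 ≤ n)
    (h0 : a 0 = 0) (han : a n = d)
    (hmono : ∀ i j, i < j → j ≤ n → a i < a j)
    (hgcd : Finset.gcd (Finset.Icc 1 n) a = 1)
    (r t : ℕ → ℕ)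
    (hr : ∀ i, i < d → (r i ∈ AperyN (Smon1 n a) d ∧ r i % d = i ∧
      ∀ y ∈ AperyN (Smon1 n a) d, y % d = i → y = r i))
    (ht : ∀ i, i < d → (t i ∈ AperyN (Smon2 n d a) d ∧ t i % d = i ∧
      ∀ y ∈ AperyN (Smon2 n d a) d, y % d = i → y = t i)) :
    (((AperyP (SmonH n d a) d).ncard = d) ↔
      (AperyP (SmonH n d a) d = insert ((0 : ℕ), (0 : ℕ))
        {p : ℕ × ℕ | ∃ i, 1 ≤ i ∧ i ≤ d - 1 ∧ p = (r i, t (d - i))}))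
    ∧
    (((AperyP (SmonH n d a) d).ncard = d) ↔
      (∀ i, 1 ≤ i → i ≤ d - 1 → ((r i, t (d - i)) : ℕ × ℕ) ∈ SmonH n d a)) := by
  have hle : ∀ i ≤ n, a i ≤ d := fun i hi => by
    rcases hi.eq_or_lt with rfl | h
    · exact han.le
    · exact han ▸ (hmono i n h le_rfl).le
  have hprod := smonH_le_prod n d a h0 han
  have h0d : ((0 : ℕ), d) ∈ SmonH n d a :=
    AddSubmonoid.subset_closure ⟨0, n.zero_le, by simp [h0]⟩
  have hd0 : (d, (0 : ℕ)) ∈ SmonH n d a :=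
    AddSubmonoid.subset_closure ⟨n, le_rfl, by simp [han]⟩
  have r0 : r 0 = 0 := ((hr 0 hd).2.2 0 (aperyN_zero_mem hd) (Nat.zero_mod d)).symm
  have t0 : t 0 = 0 := ((ht 0 hd).2.2 0 (aperyN_zero_mem hd) (Nat.zero_mod d)).symm
  set T : Set (ℕ × ℕ) := (fun i => (r i, t ((d - i) % d))) '' Set.Iio d
  have hTeq : insert ((0 : ℕ), (0 : ℕ))
      {p : ℕ × ℕ | ∃ i, 1 ≤ i ∧ i ≤ d - 1 ∧ p = (r i, t (d - i))} = T := by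
    ext p
    constructor
    · rintro (rfl | ⟨i, hi, hid, rfl⟩)
      · exact ⟨0, hd, by simp [r0, t0]⟩
      · refine ⟨i, show i < d by omega, ?_⟩
        simp only [Nat.mod_eq_of_lt (show d - i < d by omega)]
    · rintro ⟨i, hi, rfl⟩
      have hi : i < d := hi
      rcases Nat.eq_zero_or_pos i with rfl | h
      · left; simp [r0, t0]
      · right
        refine ⟨i, h, by omega, ?_⟩
        simp only [Nat.mod_eq_of_lt (show d - i < d by omega)]
  have hTcard : T.ncard = d := ncard_image_mk_Iio _ fun i hi => (hr i hi).2.1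
  have hbd : (AperyP (SmonH n d a) d).ncard = d →
      ∀ i, 1 ≤ i → i ≤ d - 1 → ((r i, t (d - i)) : ℕ × ℕ) ∈ SmonH n d a := by
    intro hb i hi hid
    have hex : ∀ i, ∃ y, i < d → (r i, y) ∈ AperyP (SmonH n d a) d := fun i => by
      by_cases h : i < d
      · obtain ⟨y, hy⟩ := exists_mk_left_mem_aperyP hd (fun p hp => (hprod hp).1) (hr i h).1
          (exists_mk_left_mem_smonH d (hr i h).1.1)
        exact ⟨y, fun _ => hy⟩
      · exact ⟨0, fun h' => absurd h' h⟩
    choose u hu using hex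
    have heq : (fun i => (r i, u i)) '' Set.Iio d = AperyP (SmonH n d a) d := by
      refine Set.eq_of_subset_of_ncard_le ?_ ?_ (Set.finite_of_ncard_pos (by omega))
      · rintro _ ⟨i, hi, rfl⟩
        exact hu i hi
      · rw [hb, ncard_image_mk_Iio _ fun i hi => (hr i hi).2.1]
    have hti := ht (d - i) (by omega)
    obtain ⟨x, hx⟩ := exists_mk_right_mem_aperyP hd (fun p hp => (hprod hp).2) hti.1
      (exists_mk_right_mem_smonH hti.1.1)
    have hxS := hx.1
    rw [← heq] at hx
    obtain ⟨k, hk, e⟩ := hx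
    have hk : k < d := hk
    obtain ⟨rfl, -⟩ := Prod.mk.inj e
    have hdvd := dvd_fst_add_snd_of_mem_smonH hle hxS
    have hmod := Nat.mod_eq_sub_mod_of_dvd_add hd (by rwa [add_comm] at hdvd)
    rw [(hr k hk).2.1, hti.2.1, Nat.sub_sub_self (by omega), Nat.mod_eq_of_lt (by omega)] at hmod
    rwa [hmod] at hxS
  have hdc : (∀ i, 1 ≤ i → i ≤ d - 1 → ((r i, t (d - i)) : ℕ × ℕ) ∈ SmonH n d a) →
      AperyP (SmonH n d a) d = T := by
    intro hS
    have hTS : ∀ i < d, (r i, t ((d - i) % d)) ∈ SmonH n d a := fun i hi => by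
      rcases Nat.eq_zero_or_pos i with rfl | h
      · rw [Nat.sub_zero, Nat.mod_self, r0, t0]
        exact (SmonH n d a).zero_mem
      · rw [Nat.mod_eq_of_lt (by omega)]
        exact hS i h (by omega)
    apply Set.Subset.antisymm
    · rintro ⟨x, y⟩ ⟨hxy, hy', hx'⟩
      obtain ⟨v, hv, k, rfl⟩ := exists_eq_aperyN_add_mul hd x (hprod hxy).1
      obtain ⟨w, hw, l, rfl⟩ := exists_eq_aperyN_add_mul hd y (hprod hxy).2
      have hmod := Nat.mod_eq_sub_mod_of_dvd_add hd (dvd_fst_add_snd_of_mem_smonH hle hxy)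
      simp only [Nat.add_mul_mod_self_right] at hmod
      have hvd := Nat.mod_lt v hd
      have hvr := (hr _ hvd).2.2 v hv rfl
      have hwt := (ht _ (Nat.mod_lt _ hd)).2.2 w hw hmod
      have hvw : (v, w) ∈ SmonH n d a := by
        have := hTS _ hvd
        rwa [← hvr, ← hwt] at this
      have hmem : ∀ k l : ℕ, (v + k * d, w + l * d) ∈ SmonH n d a := fun k l => by
        have := add_mem hvw (add_mem (nsmul_mem hd0 k) (nsmul_mem h0d l))
        simpa using this
      rcases k with _ | k
      · rcases l with _ | l
        · refine ⟨v % d, hvd, ?_⟩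
          simp [← hvr, ← hwt]
        · exact absurd ⟨_, hmem 0 l, by simp [Nat.succ_mul, add_assoc]⟩ hy'
      · exact absurd ⟨_, hmem k l, by simp [Nat.succ_mul, add_assoc]⟩ hx'
    · rintro _ ⟨i, hi, rfl⟩
      exact mk_mem_aperyP hprod (hr i hi).1 (ht _ (Nat.mod_lt _ hd)).1 (hTS i hi)
  rw [hTeq]
  have hcb : AperyP (SmonH n d a) d = T → (AperyP (SmonH n d a) d).ncard = d :=
    fun h => by rw [h, hTcard]
  exact ⟨⟨fun h => hdc (hbd h), hcb⟩, ⟨hbd, fun h => hcb (hdc h)⟩⟩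
end

section
/- Proposition 1.2: Assume that (r_i, t_{d−i}) ∈ S for all i = 1, …, d − 1 (i.e., the projective monomial curve C is arithmetically Cohen–Macaulay). Then for all (y₁, y₂), (z₁, z₂) ∈ AP_S one has (y₁, y₂) ≤_S (z₁, z₂) if and only if y₁ ≤_1 z₁ and y₂ ≤_2 z₂. -/
/-- Every element of `S` is an Apery element plus a multiple of `d`. -/
lemma exists_aperyN_add_mul {S : AddSubmonoid ℕ} {d : ℕ} (hd : 0 < d) (u : ℕ) (hu : u ∈ S) :
    ∃ w ∈ AperyN S d, ∃ k, u = w + k * d := by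
  induction u using Nat.strong_induction_on with
  | _ u ih =>
    by_cases h : ∃ s ∈ S, u = s + d
    · obtain ⟨s, hs, rfl⟩ := h
      obtain ⟨w, hw, k, rfl⟩ := ih s (by omega) hs
      exact ⟨w, hw, k + 1, by ring⟩
    · exact ⟨u, ⟨hu, h⟩, 0, by simp⟩

lemma le_of_strictMono_upTo {n d : ℕ} {a : ℕ → ℕ} (han : a n = d)
    (hmono : ∀ i j, i < j → j ≤ n → a i < a j) {i : ℕ} (hi : i ≤ n) : a i ≤ d := by
  rcases hi.lt_or_eq with h | rfl
  · exact han ▸ (hmono i n h le_rfl).le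
  · exact han.le

lemma mem_of_mem_SmonH {n d : ℕ} {a : ℕ → ℕ} (h0 : a 0 = 0) (han : a n = d)
    (hmono : ∀ i j, i < j → j ≤ n → a i < a j) {p : ℕ × ℕ} (hp : p ∈ SmonH n d a) :
    p.1 ∈ Smon1 n a ∧ p.2 ∈ Smon2 n d a ∧ d ∣ p.1 + p.2 := by
  induction hp using AddSubmonoid.closure_induction with
  | mem p hp =>
    obtain ⟨i, hi, rfl⟩ := hp
    refine ⟨?_, ?_, ?_⟩
    · rcases Nat.eq_zero_or_pos i with rfl | h
      · simp [h0]
      · exact AddSubmonoid.subset_closure ⟨i, h, hi, rfl⟩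
    · rcases hi.lt_or_eq with h | rfl
      · exact AddSubmonoid.subset_closure ⟨i, h, rfl⟩
      · simp [han]
    · have := le_of_strictMono_upTo han hmono hi
      exact (Nat.add_sub_cancel' this).symm ▸ dvd_rfl
  | zero => simp
  | add p q _ _ ihp ihq =>
    refine ⟨add_mem ihp.1 ihq.1, add_mem ihp.2.1 ihq.2.1, ?_⟩
    have : (p + q).1 + (p + q).2 = (p.1 + p.2) + (q.1 + q.2) := by
      simp only [Prod.fst_add, Prod.snd_add]; ring
    exact this ▸ dvd_add ihp.2.2 ihq.2.2

lemma add_mul_mem_SmonH {n d : ℕ} {a : ℕ → ℕ} (h0 : a 0 = 0) (han : a n = d) {u v : ℕ}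
    (h : (u, v) ∈ SmonH n d a) (k l : ℕ) : (u + k * d, v + l * d) ∈ SmonH n d a := by
  have h₁ : (d, 0) ∈ SmonH n d a :=
    AddSubmonoid.subset_closure ⟨n, le_rfl, by simp [han]⟩
  have h₂ : (0, d) ∈ SmonH n d a :=
    AddSubmonoid.subset_closure ⟨0, n.zero_le, by simp [h0]⟩
  simpa using add_mem h (add_mem (nsmul_mem h₁ k) (nsmul_mem h₂ l))

/-- Under the Cohen–Macaulay criterion, `S` consists of all pairs in `S₁ × S₂` whose coordinate
sum is divisible by `d`. -/
lemma mem_SmonH_of_dvd {n d : ℕ} {a : ℕ → ℕ} (hd : 0 < d) (h0 : a 0 = 0) (han : a n = d)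
    {r t : ℕ → ℕ}
    (hr : ∀ i, i < d → ∀ y ∈ AperyN (Smon1 n a) d, y % d = i → y = r i)
    (ht : ∀ i, i < d → ∀ y ∈ AperyN (Smon2 n d a) d, y % d = i → y = t i)
    (hACM : ∀ i, 1 ≤ i → i ≤ d - 1 → ((r i, t (d - i)) : ℕ × ℕ) ∈ SmonH n d a)
    {u v : ℕ} (hu : u ∈ Smon1 n a) (hv : v ∈ Smon2 n d a) (huv : d ∣ u + v) :
    (u, v) ∈ SmonH n d a := by
  by_cases hdu : d ∣ u
  · have hdv : d ∣ v := (Nat.dvd_add_right hdu).1 huv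
    obtain ⟨k, rfl⟩ := hdu
    obtain ⟨l, rfl⟩ := hdv
    simpa [mul_comm] using add_mul_mem_SmonH h0 han (zero_mem (SmonH n d a)) k l
  · obtain ⟨w, hw, k, rfl⟩ := exists_aperyN_add_mul hd u hu
    obtain ⟨x, hx, l, rfl⟩ := exists_aperyN_add_mul hd v hv
    apply add_mul_mem_SmonH h0 han
    have hw0 : w % d ≠ 0 := fun h =>
      hdu (dvd_add (Nat.dvd_of_mod_eq_zero h) (Dvd.intro_left k rfl))
    have hwd : w % d < d := Nat.mod_lt _ hd
    have hxd : x % d < d := Nat.mod_lt _ hd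
    have hsum : (w % d + x % d) % d = 0 := by
      have := Nat.mod_eq_zero_of_dvd huv
      simpa [Nat.add_mod] using this
    have hxw : x % d = d - w % d := by
      obtain ⟨c, hc⟩ := Nat.dvd_of_mod_eq_zero hsum
      have hc1 : c = 1 := by
        have : 0 < c := Nat.pos_of_ne_zero (by rintro rfl; omega)
        have : c < 2 := by
          by_contra! h
          have := Nat.mul_le_mul_left d h
          omega
        omega
      subst hc1
      omega
    rw [hr (w % d) hwd w hw rfl, ht (d - w % d) (by omega) x hx hxw]
    exact hACM _ (by omega) (by omega)


/-- Proposition 1.2: under the arithmetically Cohen–Macaulay criterion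
`(r i, t (d - i)) ∈ S` for `i = 1, …, d - 1`, the order `≤_S` on `AP_S` is the
componentwise product of `≤₁` and `≤₂`. -/
theorem stmt2 (n d : ℕ) (a : ℕ → ℕ) (hd : 0 < d) (hn : 2 ≤ n)
    (h0 : a 0 = 0) (han : a n = d)
    (hmono : ∀ i j, i < j → j ≤ n → a i < a j)
    (hgcd : Finset.gcd (Finset.Icc 1 n) a = 1)
    (r t : ℕ → ℕ)
    (hr : ∀ i, i < d → (r i ∈ AperyN (Smon1 n a) d ∧ r i % d = i ∧
      ∀ y ∈ AperyN (Smon1 n a) d, y % d = i → y = r i))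
    (ht : ∀ i, i < d → (t i ∈ AperyN (Smon2 n d a) d ∧ t i % d = i ∧
      ∀ y ∈ AperyN (Smon2 n d a) d, y % d = i → y = t i))
    (hACM : ∀ i, 1 ≤ i → i ≤ d - 1 → ((r i, t (d - i)) : ℕ × ℕ) ∈ SmonH n d a) :
    ∀ y ∈ AperyP (SmonH n d a) d, ∀ z ∈ AperyP (SmonH n d a) d,
      (leP (SmonH n d a) y z ↔ (leN (Smon1 n a) y.1 z.1 ∧ leN (Smon2 n d a) y.2 z.2)) := by
  intro y hy z hz
  constructor
  · rintro ⟨s, hs, rfl⟩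
    have h := mem_of_mem_SmonH h0 han hmono hs
    exact ⟨⟨s.1, h.1, rfl⟩, ⟨s.2, h.2.1, rfl⟩⟩
  · rintro ⟨⟨u, hu, hzu⟩, ⟨v, hv, hzv⟩⟩
    refine ⟨(u, v), ?_, Prod.ext hzu hzv⟩
    have hdy := (mem_of_mem_SmonH h0 han hmono hy.1).2.2
    have hdz := (mem_of_mem_SmonH h0 han hmono hz.1).2.2
    rw [hzu, hzv, add_add_add_comm] at hdz
    exact mem_SmonH_of_dvd hd h0 han (fun i hi => (hr i hi).2.2) (fun i hi => (ht i hi).2.2)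
      hACM hu hv ((Nat.dvd_add_right hdy).1 hdz)
end

section
/- Proposition 1.4 (a.2): The poset (Ap_1, ≤_1) is graded if and only if, for every y ∈ Ap_1, any two ways of writing y as a finite sum of elements of MSG(S_1) use the same number of summands; moreover, when (Ap_1, ≤_1) is graded, the function ρ_1 : Ap_1 → ℕ sending y to that common number of summands is a rank function for (Ap_1, ≤_1). -/
/-- `z` covers `y` in the poset `(AperyN S d, leN S)`. -/
def coversN (S : AddSubmonoid ℕ) (d : ℕ) (y z : ℕ) : Prop :=
  y ∈ AperyN S d ∧ z ∈ AperyN S d ∧ (leN S y z ∧ y ≠ z) ∧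
    ¬ ∃ w ∈ AperyN S d, (leN S y w ∧ y ≠ w) ∧ (leN S w z ∧ w ≠ z)

/-- `z` covers `y` in the poset `(AperyP S d, leP S)`. -/
def coversP (S : AddSubmonoid (ℕ × ℕ)) (d : ℕ) (y z : ℕ × ℕ) : Prop :=
  y ∈ AperyP S d ∧ z ∈ AperyP S d ∧ (leP S y z ∧ y ≠ z) ∧
    ¬ ∃ w ∈ AperyP S d, (leP S y w ∧ y ≠ w) ∧ (leP S w z ∧ w ≠ z)

/-- The poset `(AperyN S d, leN S)` is graded. -/
def gradedN (S : AddSubmonoid ℕ) (d : ℕ) : Prop :=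
  ∃ ρ : ℕ → ℕ, ∀ y z, coversN S d y z → ρ z = ρ y + 1

/-- The minimal system of generators of a submonoid `S ⊆ ℕ`: nonzero elements of `S`
that are not the sum of two nonzero elements of `S`. -/
def MSG (S : AddSubmonoid ℕ) : Set ℕ :=
  {x | x ∈ S ∧ x ≠ 0 ∧ ¬ ∃ u v : ℕ, u ∈ S ∧ v ∈ S ∧ u ≠ 0 ∧ v ≠ 0 ∧ x = u + v}

/-- `l` is a way of writing `y` as a finite sum of elements of `M`. -/
def sumsTo (M : Set ℕ) (y : ℕ) (l : List ℕ) : Prop :=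
  (∀ x ∈ l, x ∈ M) ∧ l.sum = y

theorem mem_AperyN_of_add_mem {S : AddSubmonoid ℕ} {d y s : ℕ} (hy : y ∈ S) (hs : s ∈ S)
    (h : y + s ∈ AperyN S d) : y ∈ AperyN S d := by
  refine ⟨hy, ?_⟩
  rintro ⟨t, ht, rfl⟩
  exact h.2 ⟨t + s, S.add_mem ht hs, by omega⟩

theorem exists_sumsTo_MSG {S : AddSubmonoid ℕ} {y : ℕ} (hy : y ∈ S) :
    ∃ l, sumsTo (MSG S) y l := by
  induction y using Nat.strong_induction_on with
  | _ y ih =>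
    by_cases h0 : y = 0
    · exact ⟨[], by simp, by simp [h0]⟩
    by_cases hm : y ∈ MSG S
    · exact ⟨[y], by simpa using hm, by simp⟩
    · have hdec : ∃ u v : ℕ, u ∈ S ∧ v ∈ S ∧ u ≠ 0 ∧ v ≠ 0 ∧ y = u + v := by
        by_contra h
        exact hm ⟨hy, h0, h⟩
      obtain ⟨u, v, hu, hv, hu0, hv0, rfl⟩ := hdec
      obtain ⟨l, hl, hls⟩ := ih u (by omega) hu
      obtain ⟨k, hk, hks⟩ := ih v (by omega) hv
      refine ⟨l ++ k, fun x hx => ?_, by simp [hls, hks]⟩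
      exact (List.mem_append.1 hx).elim (hl x) (hk x)

theorem sumsTo_MSG_mem {S : AddSubmonoid ℕ} {y : ℕ} {l : List ℕ} (h : sumsTo (MSG S) y l) :
    y ∈ S :=
  h.2 ▸ S.list_sum_mem fun x hx => (h.1 x hx).1

theorem coversN_iff {S : AddSubmonoid ℕ} {d y z : ℕ} :
    coversN S d y z ↔ y ∈ S ∧ z ∈ AperyN S d ∧ ∃ m ∈ MSG S, z = y + m := by
  constructor
  · rintro ⟨hy, hz, ⟨⟨m, hm, rfl⟩, hne⟩, hno⟩
    refine ⟨hy.1, hz, m, ⟨hm, by omega, ?_⟩, rfl⟩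
    rintro ⟨u, v, hu, hv, hu0, hv0, rfl⟩
    refine hno ⟨y + u, ?_, ⟨⟨u, hu, rfl⟩, by omega⟩, ⟨v, hv, by omega⟩, by omega⟩
    exact mem_AperyN_of_add_mem (S.add_mem hy.1 hu) hv (by rwa [add_assoc])
  · rintro ⟨hy, hz, m, ⟨hm, hm0, hno⟩, rfl⟩
    refine ⟨mem_AperyN_of_add_mem hy hm hz, hz, ⟨⟨m, hm, rfl⟩, by omega⟩, ?_⟩
    rintro ⟨w, -, ⟨⟨u, hu, rfl⟩, hu0⟩, ⟨v, hv, hv'⟩, hv0⟩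
    exact hno ⟨u, v, hu, hv, by omega, by omega, by omega⟩

theorem rank_eq_add_length {S : AddSubmonoid ℕ} {d : ℕ} {ρ : ℕ → ℕ}
    (hρ : ∀ y z, coversN S d y z → ρ z = ρ y + 1) (l : List ℕ) :
    ∀ y ∈ AperyN S d, sumsTo (MSG S) y l → ρ y = ρ 0 + l.length := by
  induction l with
  | nil =>
    rintro y - ⟨-, rfl⟩
    simp
  | cons m l ih =>
    rintro y hy ⟨hl, rfl⟩
    have hm : m ∈ MSG S := hl m (by simp)
    have hsum : sumsTo (MSG S) l.sum l := ⟨fun x hx => hl x (by simp [hx]), rfl⟩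
    have hmem := sumsTo_MSG_mem hsum
    rw [List.sum_cons, add_comm] at hy ⊢
    rw [hρ _ _ (coversN_iff.2 ⟨hmem, hy, m, hm, rfl⟩),
      ih _ (mem_AperyN_of_add_mem hmem hm.1 hy) hsum, List.length_cons, add_assoc]

theorem rank_of_eq_length {S : AddSubmonoid ℕ} {d : ℕ} {ρ : ℕ → ℕ}
    (hρ : ∀ y ∈ AperyN S d, ∀ l : List ℕ, sumsTo (MSG S) y l → ρ y = l.length) (y z : ℕ)
    (h : coversN S d y z) : ρ z = ρ y + 1 := by
  obtain ⟨hy, hz, m, hm, rfl⟩ := coversN_iff.1 h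
  obtain ⟨l, hl⟩ := exists_sumsTo_MSG hy
  have hml : sumsTo (MSG S) (y + m) (m :: l) :=
    ⟨List.forall_mem_cons.2 ⟨hm, hl.1⟩, by simp [hl.2, add_comm]⟩
  rw [hρ _ h.1 l hl, hρ _ hz _ hml, List.length_cons]

theorem gradedN_iff_length_eq (S : AddSubmonoid ℕ) (d : ℕ) :
    gradedN S d ↔ ∀ y ∈ AperyN S d, ∀ l l' : List ℕ,
      sumsTo (MSG S) y l → sumsTo (MSG S) y l' → l.length = l'.length := by
  classical
  constructor
  · rintro ⟨ρ, hρ⟩ y hy l l' hl hl'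
    have h := rank_eq_add_length hρ l y hy hl
    have h' := rank_eq_add_length hρ l' y hy hl'
    omega
  · intro h
    refine ⟨fun y => if hy : ∃ l, sumsTo (MSG S) y l then hy.choose.length else 0,
      rank_of_eq_length fun y hy l hl => ?_⟩
    have hex : ∃ l, sumsTo (MSG S) y l := ⟨l, hl⟩
    simpa only [dif_pos hex] using h y hy _ _ hex.choose_spec hl

/-- Proposition 1.4 (a.2): `(Ap₁, ≤₁)` is graded iff every way of writing an element of
`Ap₁` as a sum of minimal generators of `S₁` has the same number of summands; moreover,
in that case the function sending each element of `Ap₁` to that common number of summands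
is a rank function. -/
theorem stmt4 (n d : ℕ) (a : ℕ → ℕ) (hd : 0 < d) (hn : 2 ≤ n)
    (h0 : a 0 = 0) (han : a n = d)
    (hmono : ∀ i j, i < j → j ≤ n → a i < a j)
    (hgcd : Finset.gcd (Finset.Icc 1 n) a = 1) :
    (gradedN (Smon1 n a) d ↔
      ∀ y ∈ AperyN (Smon1 n a) d, ∀ l l' : List ℕ,
        sumsTo (MSG (Smon1 n a)) y l → sumsTo (MSG (Smon1 n a)) y l' →
          l.length = l'.length)
    ∧
    (gradedN (Smon1 n a) d →
      ∀ ρ : ℕ → ℕ,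
        (∀ y ∈ AperyN (Smon1 n a) d, ∀ l : List ℕ,
          sumsTo (MSG (Smon1 n a)) y l → ρ y = l.length) →
        ∀ y z, coversN (Smon1 n a) d y z → ρ z = ρ y + 1) := by
  exact ⟨gradedN_iff_length_eq _ _, fun _ _ hρ => rank_of_eq_length hρ⟩
end
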